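/- Let x_1, …, x_n ∈ ℝ^d have arithmetic mean A, and for p ∈ ℝ^d let Σ_p := (1/n) Σ_{i=1}^n (x_i − p)(x_i − p)ᵀ. Let 1 ≤ k ≤ d and let e_1, …, e_k be orthonormal eigenvectors of Σ_A corresponding to its k largest eigenvalues λ_1(Σ_A) ≥ … ≥ λ_k(Σ_A). Then for every B in the affine subspace A + span{e_1, …, e_k}, one has Σ_{j=1}^k λ_j(Σ_B) = Σ_{j=1}^k λ_j(Σ_A) + ‖B − A‖²; that is, every point of the principal-component affine subspace attains, with equality, the upper bound Σ_{j=1}^k λ_j(Σ_B) ≤ Σ_{j=1}^k λ_j(Σ_A) + ‖B − A‖² valid for all B ∈ ℝ^d. -/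

import Mathlib

open Matrix

/-- Bessel's inequality for a matrix with orthonormal rows. -/
theorem mulVec_dotProduct_mulVec_le {ι κ : Type*} [Fintype ι] [Fintype κ] [DecidableEq κ]
    {F : Matrix κ ι ℝ} (hF : F * Fᵀ = 1) (v : ι → ℝ) :
    (F *ᵥ v) ⬝ᵥ (F *ᵥ v) ≤ v ⬝ᵥ v := by
  have h1 : v ⬝ᵥ (Fᵀ *ᵥ (F *ᵥ v)) = (F *ᵥ v) ⬝ᵥ (F *ᵥ v) := by
    rw [dotProduct_mulVec, vecMul_transpose]
  have h2 : (Fᵀ *ᵥ (F *ᵥ v)) ⬝ᵥ (Fᵀ *ᵥ (F *ᵥ v)) = (F *ᵥ v) ⬝ᵥ (F *ᵥ v) := by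
    rw [dotProduct_mulVec, vecMul_transpose, mulVec_mulVec, hF, one_mulVec]
  have h3 : 0 ≤ (v - Fᵀ *ᵥ (F *ᵥ v)) ⬝ᵥ (v - Fᵀ *ᵥ (F *ᵥ v)) :=
    Finset.sum_nonneg fun i _ => mul_self_nonneg _
  rw [sub_dotProduct, dotProduct_sub, dotProduct_sub, h2, dotProduct_comm (Fᵀ *ᵥ _) v, h1] at h3
  linarith

theorem trace_mul_vecMulVec_mul_transpose {ι κ : Type*} [Fintype ι] [Fintype κ]
    (F : Matrix κ ι ℝ) (v : ι → ℝ) :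
    (F * vecMulVec v v * Fᵀ).trace = (F *ᵥ v) ⬝ᵥ (F *ᵥ v) := by
  rw [mul_vecMulVec, vecMulVec_mul, vecMul_transpose, trace_vecMulVec]

theorem sum_mul_le_sum_castLE {d k : ℕ} (hk : 1 ≤ k) (hkd : k ≤ d) {μ w : Fin d → ℝ}
    (hμ : Antitone μ) (hw0 : ∀ l, 0 ≤ w l) (hw1 : ∀ l, w l ≤ 1) (hw : ∑ l, w l = k) :
    ∑ l, μ l * w l ≤ ∑ j : Fin k, μ (Fin.castLE hkd j) := by
  have hsum : ∀ f : Fin d → ℝ,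
      ∑ j : Fin k, f (Fin.castLE hkd j) = ∑ l, f l * if (l : ℕ) < k then 1 else 0 := by
    intro f
    obtain ⟨m, rfl⟩ := Nat.exists_eq_add_of_le hkd
    rw [Fin.sum_univ_add]
    simp [Fin.castAdd]
  set c := μ ⟨k - 1, by omega⟩
  have hcount : ∑ l : Fin d, (if (l : ℕ) < k then (1 : ℝ) else 0) = k := by
    simpa using (hsum fun _ => 1).symm
  have key : ∑ l, (μ l - c) * (w l - if (l : ℕ) < k then 1 else 0) ≤ 0 := by
    refine Finset.sum_nonpos fun l _ => ?_
    split_ifs with h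
    · have : c ≤ μ l := hμ (Fin.le_def.2 (by simp only; omega))
      exact mul_nonpos_of_nonneg_of_nonpos (by linarith) (by linarith [hw1 l])
    · have : μ l ≤ c := hμ (Fin.le_def.2 (by simp only; omega))
      exact mul_nonpos_of_nonpos_of_nonneg (by linarith) (by linarith [hw0 l])
  simp only [sub_mul, mul_sub, Finset.sum_sub_distrib, ← Finset.mul_sum, hw, hcount] at key
  rw [hsum]
  linarith

/-- **Ky Fan's inequality**: the trace of a compression to `k` orthonormal vectors is at most the
sum of the `k` largest eigenvalues. -/
theorem trace_compression_le_sum_castLE {d k : ℕ} (hk : 1 ≤ k) (hkd : k ≤ d) {μ : Fin d → ℝ}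
    (hμ : Antitone μ) {U : Matrix (Fin d) (Fin d) ℝ} (hU : U * Uᵀ = 1)
    {F : Matrix (Fin k) (Fin d) ℝ} (hF : F * Fᵀ = 1) :
    (F * (U * diagonal μ * Uᵀ) * Fᵀ).trace ≤ ∑ j : Fin k, μ (Fin.castLE hkd j) := by
  set G := F * U with hG
  have hGG : G * Gᵀ = 1 := by
    rw [hG, transpose_mul, Matrix.mul_assoc, ← Matrix.mul_assoc U, hU, Matrix.one_mul, hF]
  have hF' : F * (U * diagonal μ * Uᵀ) * Fᵀ = G * diagonal μ * Gᵀ := by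
    simp only [hG, transpose_mul, Matrix.mul_assoc]
  have htrace : ∀ f : Fin d → ℝ,
      (G * diagonal f * Gᵀ).trace = ∑ l, f l * ∑ j, G j l * G j l := by
    intro f
    simp only [trace, diag_apply, mul_apply (M := G * diagonal f), mul_diagonal, transpose_apply,
      Finset.mul_sum]
    rw [Finset.sum_comm]
    exact Finset.sum_congr rfl fun _ _ => Finset.sum_congr rfl fun _ _ => by ring
  rw [hF', htrace]
  refine sum_mul_le_sum_castLE hk hkd hμ
    (fun l => Finset.sum_nonneg fun j _ => mul_self_nonneg _) (fun l => ?_) ?_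
  · simpa [dotProduct, Pi.single_apply] using mulVec_dotProduct_mulVec_le hGG (Pi.single l 1)
  · simpa [hGG] using (htrace fun _ => 1).symm

theorem exists_trace_compression_eq_sum_castLE {d k : ℕ} (hkd : k ≤ d) (μ : Fin d → ℝ)
    {U : Matrix (Fin d) (Fin d) ℝ} (hU : U * Uᵀ = 1) :
    ∃ F : Matrix (Fin k) (Fin d) ℝ, F * Fᵀ = 1 ∧
      (F * (U * diagonal μ * Uᵀ) * Fᵀ).trace = ∑ j : Fin k, μ (Fin.castLE hkd j) := by
  have hU' : Uᵀ * U = 1 := mul_eq_one_comm.1 hU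
  have hinj : Function.Injective (Fin.castLE hkd) := Fin.castLE_injective hkd
  have hsub : ∀ M : Matrix (Fin d) (Fin d) ℝ,
      Uᵀ.submatrix (Fin.castLE hkd) id * M * (Uᵀ.submatrix (Fin.castLE hkd) id)ᵀ
        = (Uᵀ * M * U).submatrix (Fin.castLE hkd) (Fin.castLE hkd) := by
    intro M
    ext i j
    simp [mul_apply]
  refine ⟨Uᵀ.submatrix (Fin.castLE hkd) id, ?_, ?_⟩
  · have := hsub 1
    rw [Matrix.mul_one, Matrix.mul_one, hU', submatrix_one _ hinj] at this
    exact this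
  · have hD : Uᵀ * (U * diagonal μ * Uᵀ) * U = diagonal μ := by
      rw [Matrix.mul_assoc, Matrix.mul_assoc (U * _), hU', Matrix.mul_one, ← Matrix.mul_assoc, hU',
        Matrix.one_mul]
    rw [hsub, hD]
    simp [trace]

theorem covariance_eq_add_vecMulVec {ι : Type*} {n : ℕ} (hn : 0 < n) (x : Fin n → ι → ℝ)
    {A : ι → ℝ} (hA : A = (n : ℝ)⁻¹ • ∑ i, x i) (B : ι → ℝ) :
    (n : ℝ)⁻¹ • ∑ i, vecMulVec (x i - B) (x i - B)
      = (n : ℝ)⁻¹ • ∑ i, vecMulVec (x i - A) (x i - A) + vecMulVec (B - A) (B - A) := by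
  have hn' : (n : ℝ) ≠ 0 := by positivity
  have hzero : ∀ a, ∑ i, (x i a - A a) = 0 := by
    intro a
    simp [hA, Finset.sum_sub_distrib, mul_inv_cancel_left₀ hn']
  ext a b
  simp only [Matrix.smul_apply, Matrix.sum_apply, Matrix.add_apply, vecMulVec_apply, Pi.sub_apply,
    smul_eq_mul]
  have hexp : ∀ i, (x i a - B a) * (x i b - B b) = (x i a - A a) * (x i b - A b)
      - (x i a - A a) * (B b - A b) - (B a - A a) * (x i b - A b)
      + (B a - A a) * (B b - A b) := fun i => by ring
  simp only [hexp, Finset.sum_add_distrib, Finset.sum_sub_distrib (f := fun i => _ - _),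
    Finset.sum_sub_distrib (f := fun i => (x i a - A a) * (x i b - A b)),
    ← Finset.sum_mul, ← Finset.mul_sum, hzero, Finset.sum_const, Finset.card_univ,
    Fintype.card_fin, nsmul_eq_mul]
  field_simp
  ring

/-- Equality case underlying Theorem 1: with data `x 1, …, x n` in `ℝ^d`, mean `A`,
covariance matrices `Σ_p = (1/n) Σᵢ (xᵢ − p)(xᵢ − p)ᵀ`, and `e 0, …, e (k-1)`
orthonormal eigenvectors of `Σ_A` for its `k` largest eigenvalues, every point `B`
of the affine subspace `A + span{e 0, …, e (k-1)}` satisfies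
`Σ_{j<k} λ_j(Σ_B) = Σ_{j<k} λ_j(Σ_A) + ‖B − A‖²`, i.e. it attains with equality the
upper bound valid for all `B ∈ ℝ^d`.  Eigenvalues in decreasing order with
multiplicity are encoded by antitone functions together with orthogonal
diagonalizations. -/
theorem stmt_6 {d n k : ℕ} (hn : 0 < n) (hk1 : 1 ≤ k) (hkd : k ≤ d)
    (x : Fin n → (Fin d → ℝ))
    (A : Fin d → ℝ) (hA : A = (n : ℝ)⁻¹ • ∑ i, x i)
    (SA : Matrix (Fin d) (Fin d) ℝ)
    (hSA : SA = (n : ℝ)⁻¹ • ∑ i, Matrix.vecMulVec (x i - A) (x i - A))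
    (μ : Fin d → ℝ) (hμ : Antitone μ)
    (U : Matrix (Fin d) (Fin d) ℝ) (hU : U * Uᵀ = 1)
    (hAdec : SA = U * Matrix.diagonal μ * Uᵀ)
    (e : Fin k → (Fin d → ℝ))
    (heortho : ∀ i j : Fin k, ∑ l, e i l * e j l = if i = j then 1 else 0)
    (heeig : ∀ j : Fin k, SA.mulVec (e j) = μ (Fin.castLE hkd j) • e j)
    (B : Fin d → ℝ) (hB : B - A ∈ Submodule.span ℝ (Set.range e))
    (SB : Matrix (Fin d) (Fin d) ℝ)
    (hSB : SB = (n : ℝ)⁻¹ • ∑ i, Matrix.vecMulVec (x i - B) (x i - B))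
    (ν : Fin d → ℝ) (hν : Antitone ν)
    (V : Matrix (Fin d) (Fin d) ℝ) (hV : V * Vᵀ = 1)
    (hBdec : SB = V * Matrix.diagonal ν * Vᵀ) :
    ∑ j : Fin k, ν (Fin.castLE hkd j)
      = ∑ j : Fin k, μ (Fin.castLE hkd j) + ∑ i, (B i - A i) ^ 2 := by
  have hS : SB = SA + vecMulVec (B - A) (B - A) := by
    rw [hSB, hSA, covariance_eq_add_vecMulVec hn x hA B]
  have hcomp : ∀ F : Matrix (Fin k) (Fin d) ℝ, (F * SB * Fᵀ).trace
      = (F * SA * Fᵀ).trace + (F *ᵥ (B - A)) ⬝ᵥ (F *ᵥ (B - A)) := by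
    intro F
    rw [hS, Matrix.mul_add, Matrix.add_mul, trace_add, trace_mul_vecMulVec_mul_transpose]
  have hnorm : ∑ i, (B i - A i) ^ 2 = (B - A) ⬝ᵥ (B - A) := by
    simp [dotProduct, sq]
  rw [hnorm]
  apply le_antisymm
  · obtain ⟨F, hF, hFtr⟩ := exists_trace_compression_eq_sum_castLE hkd ν hV
    rw [← hFtr, ← hBdec, hcomp, hAdec]
    exact add_le_add (trace_compression_le_sum_castLE hk1 hkd hμ hU hF)
      (mulVec_dotProduct_mulVec_le hF _)
  · have hE : of e * (of e)ᵀ = 1 := by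
      ext i j
      simp [mul_apply, one_apply, heortho]
    have hEA : (of e * SA * (of e)ᵀ).trace = ∑ j : Fin k, μ (Fin.castLE hkd j) := by
      refine Finset.sum_congr rfl fun j _ => ?_
      have hj : e j ⬝ᵥ e j = 1 := by simp [dotProduct, heortho]
      calc (of e * SA * (of e)ᵀ) j j = e j ⬝ᵥ SA *ᵥ e j := by
            rw [Matrix.mul_assoc]; rfl
        _ = μ (Fin.castLE hkd j) := by simp [heeig, hj]
    have hEv : (of e *ᵥ (B - A)) ⬝ᵥ (of e *ᵥ (B - A)) = (B - A) ⬝ᵥ (B - A) := by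
      obtain ⟨c, hc⟩ := (Submodule.mem_span_range_iff_exists_fun ℝ).1 hB
      have hc' : B - A = (of e)ᵀ *ᵥ c := by
        rw [← hc, mulVec_transpose, vecMul_eq_sum]
        rfl
      rw [hc', mulVec_mulVec, hE, one_mulVec, dotProduct_mulVec, vecMul_transpose, mulVec_mulVec,
        hE, one_mulVec]
    rw [← hEA, ← hEv, ← hcomp, hBdec]
    exact trace_compression_le_sum_castLE hk1 hkd hν hV hE
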